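/- Assume g is odd and g+1 divides 4h+2. Then for every place v of K (finite or archimedean), every finite field extension L of the completion K_v, and every θ ∈ L ∪ {∞}, the surface S_θ has an L-point: there exists a nonzero tuple (x, y, z, u, v) ∈ L⁵ with x² − a z² = −b (u − A_θ v)(u − B_θ v) and x² − a y² = −a C_θ² u v. -/

import Mathlib

open NumberField IsDedekindDomain

universe u

/-- `D_θ = a^{2h+1} b^{2h+1} θ^{g+1} − 1`. -/
def Dval {F : Type*} [Field F] (a b : F) (h g : ℕ) (θ : F) : F :=
  a ^ (2 * h + 1) * b ^ (2 * h + 1) * θ ^ (g + 1) - 1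

/-- `C_θ = a^{2h+1} θ^{g+1} − 1`. -/
def Cval {F : Type*} [Field F] (a : F) (h g : ℕ) (θ : F) : F :=
  a ^ (2 * h + 1) * θ ^ (g + 1) - 1

/-- `A_θ = a^{4h+3} θ^{2g+2} + b c² d D_θ²`. -/
def Aval {F : Type*} [Field F] (a b c d : F) (h g : ℕ) (θ : F) : F :=
  a ^ (4 * h + 3) * θ ^ (2 * g + 2) + b * c ^ 2 * d * (Dval a b h g θ) ^ 2

/-- `B_θ = a^{4h+3} θ^{2g+2} + (b c² d + 2c) D_θ²`. -/
def Bval {F : Type*} [Field F] (a b c d : F) (h g : ℕ) (θ : F) : F :=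
  a ^ (4 * h + 3) * θ ^ (2 * g + 2) + (b * c ^ 2 * d + 2 * c) * (Dval a b h g θ) ^ 2

/-- `D_∞ = a^{2h+1} b^{2h+1}`. -/
def Dinf {F : Type*} [Field F] (a b : F) (h : ℕ) : F := a ^ (2 * h + 1) * b ^ (2 * h + 1)

/-- `C_∞ = a^{2h+1}`. -/
def Cinf {F : Type*} [Field F] (a : F) (h : ℕ) : F := a ^ (2 * h + 1)

/-- `A_∞ = a^{4h+3} + b c² d D_∞²`. -/
def Ainf {F : Type*} [Field F] (a b c d : F) (h : ℕ) : F :=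
  a ^ (4 * h + 3) + b * c ^ 2 * d * (Dinf a b h) ^ 2

/-- `B_∞ = a^{4h+3} + (b c² d + 2c) D_∞²`. -/
def Binf {F : Type*} [Field F] (a b c d : F) (h : ℕ) : F :=
  a ^ (4 * h + 3) + (b * c ^ 2 * d + 2 * c) * (Dinf a b h) ^ 2

/-- The image of `x ∈ 𝓞 K` in the completion of `K` at the finite place `π`. -/
noncomputable def intToAdicCompletion {K : Type*} [Field K] [NumberField K]
    (π : HeightOneSpectrum (𝓞 K)) (x : 𝓞 K) : π.adicCompletion K :=
  algebraMap K (π.adicCompletion K) (algebraMap (𝓞 K) K x)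

/-- The arithmetic parameters `a, b, c, d` of Proposition 2.1 of Huang–Liang, for the
finite set `Ω⁰` of finite odd places of residue characteristic at most `4g²`;
`va, vb, vc, vd` are the finite places of `K` generated by `a, b, c, d`. -/
structure Params (K : Type u) [Field K] [NumberField K] (g : ℕ) (a b c d : 𝓞 K)
    (va vb vc vd : HeightOneSpectrum (𝓞 K)) : Prop where
  span_a : va.asIdeal = Ideal.span {a}
  span_b : vb.asIdeal = Ideal.span {b}
  span_c : vc.asIdeal = Ideal.span {c}
  span_d : vd.asIdeal = Ideal.span {d}
  distinct : va ≠ vb ∧ va ≠ vc ∧ va ≠ vd ∧ vb ≠ vc ∧ vb ≠ vd ∧ vc ≠ vd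
  not_dvd_two : (2 : 𝓞 K) ∉ va.asIdeal ∧ (2 : 𝓞 K) ∉ vb.asIdeal ∧
    (2 : 𝓞 K) ∉ vc.asIdeal ∧ (2 : 𝓞 K) ∉ vd.asIdeal
  char_odd : Odd (ringChar (𝓞 K ⧸ va.asIdeal)) ∧ Odd (ringChar (𝓞 K ⧸ vb.asIdeal)) ∧
    Odd (ringChar (𝓞 K ⧸ vc.asIdeal)) ∧ Odd (ringChar (𝓞 K ⧸ vd.asIdeal))
  char_big : 4 * g ^ 2 < ringChar (𝓞 K ⧸ va.asIdeal) ∧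
    4 * g ^ 2 < ringChar (𝓞 K ⧸ vb.asIdeal) ∧
    4 * g ^ 2 < ringChar (𝓞 K ⧸ vc.asIdeal) ∧
    4 * g ^ 2 < ringChar (𝓞 K ⧸ vd.asIdeal)
  sq_ab_bad : ∀ π : HeightOneSpectrum (𝓞 K),
    ((2 : 𝓞 K) ∈ π.asIdeal ∨ ringChar (𝓞 K ⧸ π.asIdeal) ≤ 4 * g ^ 2) →
    IsSquare (intToAdicCompletion π a) ∧ IsSquare (intToAdicCompletion π b)
  pos_real : ∀ σ : K →+* ℝ, 0 < σ (algebraMap (𝓞 K) K a) ∧ 0 < σ (algebraMap (𝓞 K) K b)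
  sq_two_a : IsSquare ((2 : va.adicCompletion K))
  sq_neg_one_a : IsSquare ((-1 : va.adicCompletion K))
  sq_two_b : IsSquare ((2 : vb.adicCompletion K))
  sq_neg_one_b : IsSquare ((-1 : vb.adicCompletion K))
  cong_a : b ∣ a - 1
  cong_bcd : a ∣ b * c ^ 2 * d - 1
  c_nsq_a : ¬ IsSquare (intToAdicCompletion va c)
  c_nsq_b : ¬ IsSquare (intToAdicCompletion vb c)
  d_nsq_b : ¬ IsSquare (intToAdicCompletion vb d)
  d_sq_c : IsSquare (intToAdicCompletion vc d)
  d_sq_a : IsSquare (intToAdicCompletion va d)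
  a_sq_b : IsSquare (intToAdicCompletion vb a)
  a_nsq_c : ¬ IsSquare (intToAdicCompletion vc a)
  b_sq_a : IsSquare (intToAdicCompletion va b)
  b_nsq_c : ¬ IsSquare (intToAdicCompletion vc b)
  not_dvd : ¬ a ∣ b * c * d + 2

/-- The del Pezzo surface `x² − a z² = −b(u − Av)(u − Bv)`, `x² − a y² = −a C² u v`
in ℙ⁴ has an `L`-point. -/
def SPoint {L : Type*} [Field L] (a b A B C : L) : Prop :=
  ∃ x y z u v : L, ¬ (x = 0 ∧ y = 0 ∧ z = 0 ∧ u = 0 ∧ v = 0) ∧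
    x ^ 2 - a * z ^ 2 = -(b * ((u - A * v) * (u - B * v))) ∧
    x ^ 2 - a * y ^ 2 = -(a * C ^ 2 * (u * v))

/-- The fibers `S_θ` for all `θ ∈ L ∪ {∞}` have `L`-points. -/
def SAllFibers {L : Type*} [Field L] (h g : ℕ) (a b c d : L) : Prop :=
  (∀ θ : L, SPoint a b (Aval a b c d h g θ) (Bval a b c d h g θ) (Cval a h g θ)) ∧
  SPoint a b (Ainf a b c d h) (Binf a b c d h) (Cinf a h)

/-- The image of `x ∈ 𝓞 K` in a field extension `L` of the completion `K_π`. -/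
noncomputable def intToLocalExt {K : Type u} [Field K] [NumberField K]
    (π : HeightOneSpectrum (𝓞 K)) (L : Type u) [Field L]
    [Algebra (π.adicCompletion K) L] (x : 𝓞 K) : L :=
  algebraMap (π.adicCompletion K) L (intToAdicCompletion π x)

theorem sum_quadraticChar_sq_sub {F : Type*} [Field F] [Fintype F] [DecidableEq F]
    (hF : ringChar F ≠ 2) {q : F} (hq : q ≠ 0) :
    ∑ x : F, quadraticChar F (x ^ 2 - q) = -1 := by
  have h2 : (2 : F) ≠ 0 := Ring.two_ne_zero hF
  have key : ∀ x : F, quadraticChar F (x ^ 2 - q) + 1 =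
      ((Finset.univ.filter fun w : F => w ^ 2 = x ^ 2 - q).card : ℤ) := by
    intro x
    rw [← quadraticChar_card_sqrts hF]
    congr 2
    ext w
    simp
  have hcard : ∑ x : F, (Finset.univ.filter fun w : F => w ^ 2 = x ^ 2 - q).card
      = Fintype.card Fˣ := by
    rw [← Finset.card_sigma, ← Finset.card_univ]
    refine Finset.card_bij' (fun p _ => if h : p.1 - p.2 = 0 then 1 else Units.mk0 (p.1 - p.2) h)
      (fun u _ => ⟨(u + q / u) / 2, (q / u - u) / 2⟩) ?_ ?_ ?_ ?_
    · simp
    · intro u _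
      simp only [Finset.mem_sigma, Finset.mem_univ, Finset.mem_filter, true_and]
      field_simp
      ring
    · rintro ⟨x, w⟩ hp
      simp only [Finset.mem_sigma, Finset.mem_univ, Finset.mem_filter, true_and] at hp
      have hmul : (x - w) * (x + w) = q := by linear_combination -hp
      have h0 : x - w ≠ 0 := by
        intro h
        rw [h, zero_mul] at hmul
        exact hq hmul.symm
      have hdiv : q / (x - w) = x + w := by
        rw [← hmul]; field_simp
      simp only [h0, dif_neg, not_false_eq_true, Units.val_mk0, hdiv]
      rw [Sigma.mk.injEq]
      refine ⟨by field_simp; ring, heq_of_eq (by field_simp; ring)⟩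
    · intro u _
      have : (u + q / u) / 2 - (q / u - u) / 2 = (u : F) := by field_simp; ring
      simp [this]
  have hsum : ∑ x : F, (quadraticChar F (x ^ 2 - q) + 1) = (Fintype.card Fˣ : ℤ) := by
    rw [← hcard]
    push_cast
    exact Finset.sum_congr rfl fun x _ => key x
  rw [Finset.sum_add_distrib, Finset.sum_const, Finset.card_univ, nsmul_eq_mul, mul_one,
    Fintype.card_units, Nat.cast_sub Fintype.card_pos] at hsum
  push_cast at hsum
  linarith

theorem eq_mul_sq_of_quadraticChar_ne_one {F : Type*} [Field F] [Fintype F] [DecidableEq F]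
    {α w : F} (hα : ¬ IsSquare α) (hw : quadraticChar F w ≠ 1) : ∃ z, w = α * z ^ 2 := by
  rcases eq_or_ne w 0 with rfl | hw0
  · exact ⟨0, by simp⟩
  have hα0 : α ≠ 0 := by rintro rfl; exact hα (IsSquare.zero)
  have h1 : quadraticChar F w = -1 := (quadraticChar_dichotomy hw0).resolve_left hw
  have h2 : quadraticChar F α = -1 := quadraticChar_neg_one_iff_not_isSquare.mpr hα
  have h3 : quadraticChar F (w * α) = 1 := by rw [map_mul, h1, h2]; norm_num
  obtain ⟨r, hr⟩ := (quadraticChar_one_iff_isSquare (mul_ne_zero hw0 hα0)).mp h3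
  refine ⟨r / α, ?_⟩
  field_simp
  linear_combination hr

/-- Over a finite field of odd characteristic, two nonzero elements are simultaneously of the form
`x ^ 2 - α * _ ^ 2` for the same `x`, with at least one of the other coordinates nonzero. -/
theorem exists_common_sq_sub_mul_sq {F : Type*} [Field F] [Finite F]
    (hF : ringChar F ≠ 2) {α q₁ q₂ : F} (hα : ¬ IsSquare α) (h₁ : q₁ ≠ 0) (h₂ : q₂ ≠ 0) :
    ∃ x y z : F, x ^ 2 - α * z ^ 2 = q₁ ∧ x ^ 2 - α * y ^ 2 = q₂ ∧ (y ≠ 0 ∨ z ≠ 0) := by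
  classical
  have := Fintype.ofFinite F
  have hle : ∀ w : F, -1 ≤ quadraticChar F w ∧ quadraticChar F w ≤ 1 := by
    intro w
    rcases eq_or_ne w 0 with rfl | h
    · simp
    · rcases quadraticChar_dichotomy h with h | h <;> rw [h] <;> norm_num
  rcases eq_or_ne q₁ q₂ with rfl | hne
  · by_contra! hcon
    have h0 : ∀ x : F, 0 ≤ quadraticChar F (x ^ 2 - q₁) := by
      intro x
      by_contra! hx
      obtain ⟨z, hz⟩ := eq_mul_sq_of_quadraticChar_ne_one hα (w := x ^ 2 - q₁) (by linarith)
      have h := hcon x z z (by linear_combination hz) (by linear_combination hz)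
      rw [hz, h.1] at hx
      simp at hx
    have := Finset.sum_nonneg fun x (_ : x ∈ Finset.univ) => h0 x
    rw [sum_quadraticChar_sq_sub hF h₁] at this
    norm_num at this
  · obtain ⟨x, hx₁, hx₂⟩ : ∃ x : F, quadraticChar F (x ^ 2 - q₁) ≠ 1 ∧
        quadraticChar F (x ^ 2 - q₂) ≠ 1 := by
      by_contra! hcon
      have hprod : ∀ x : F, 0 ≤ quadraticChar F (x ^ 2 - q₁) + quadraticChar F (x ^ 2 - q₂) := by
        intro x
        by_cases h : quadraticChar F (x ^ 2 - q₁) = 1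
        · linarith [(hle (x ^ 2 - q₂)).1]
        · linarith [(hle (x ^ 2 - q₁)).1, hcon x h]
      have := Finset.sum_nonneg fun x (_ : x ∈ Finset.univ) => hprod x
      rw [Finset.sum_add_distrib, sum_quadraticChar_sq_sub hF h₁,
        sum_quadraticChar_sq_sub hF h₂] at this
      norm_num at this
    obtain ⟨z, hz⟩ := eq_mul_sq_of_quadraticChar_ne_one hα hx₁
    obtain ⟨y, hy⟩ := eq_mul_sq_of_quadraticChar_ne_one hα hx₂
    refine ⟨x, y, z, by linear_combination hz, by linear_combination hy, ?_⟩
    by_contra! h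
    rw [h.1] at hy
    rw [h.2] at hz
    exact hne (by linear_combination hy - hz)

section Valuation

variable {L Γ : Type*} [Field L] [LinearOrderedCommGroupWithZero Γ] {v : Valuation L Γ}

theorem isSquare_of_valuation_sub_sq_lt (hv : ∀ x, v x < 1 → IsSquare (1 + x)) {w r : L}
    (h : v (w - r ^ 2) < v (r ^ 2)) : IsSquare w := by
  have hr : r ^ 2 ≠ 0 := by
    intro h0
    rw [h0, map_zero] at h
    exact not_lt_zero h
  have h1 : v ((w - r ^ 2) / r ^ 2) < 1 := by
    rw [map_div₀]
    exact (div_lt_one₀ (lt_of_le_of_lt zero_le h)).mpr h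
  have h2 : w = r ^ 2 * (1 + (w - r ^ 2) / r ^ 2) := by
    rw [mul_add, mul_div_cancel₀ _ hr]; ring
  rw [h2]
  exact (IsSquare.sq r).mul (hv _ h1)

section Residue

variable {F : Type*} [Field F] {f : v.integer →+* F}

theorem isSquare_of_residue_eq_sq (hv : ∀ x, v x < 1 → IsSquare (1 + x))
    (hker : ∀ x, f x = 0 ↔ v x < 1) {w r : v.integer} (hr : f r ≠ 0)
    (h : f w = f r ^ 2) : IsSquare (w : L) := by
  refine isSquare_of_valuation_sub_sq_lt (v := v) hv (r := (r : L)) ?_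
  have h1 : v (r : L) = 1 := le_antisymm r.2 (not_lt.mp fun hlt => hr ((hker r).mpr hlt))
  rw [map_pow, h1, one_pow]
  exact (hker (w - r ^ 2)).mp (by rw [map_sub, map_pow, h, sub_self])

theorem exists_sq_sub_eq_of_residue (hv : ∀ x, v x < 1 → IsSquare (1 + x))
    (hsurj : Function.Surjective f) (hker : ∀ x, f x = 0 ↔ v x < 1) {a x q : v.integer} {z : F}
    (ha : v (a : L) = 1) (hz : z ≠ 0) (h : f x ^ 2 - f a * z ^ 2 = f q) :
    ∃ t : L, (x : L) ^ 2 - a * t ^ 2 = q := by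
  have hfa : f a ≠ 0 := fun h0 => (((hker a).mp h0).trans_eq ha.symm).false
  have ha0 : (a : L) ≠ 0 := fun h0 => by simp [h0] at ha
  obtain ⟨r, rfl⟩ := hsurj z
  obtain ⟨s, hs⟩ := isSquare_of_residue_eq_sq hv hker (w := a * (x ^ 2 - q)) (r := a * r)
    (by rw [map_mul]; exact mul_ne_zero hfa hz)
    (by simp only [map_mul, map_sub, map_pow]; linear_combination f a * h)
  refine ⟨s / a, ?_⟩
  push_cast at hs
  field_simp
  linear_combination hs

/-- Over a henselian valued field with finite residue field of odd characteristic, two units are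
simultaneously of the form `x ^ 2 - a * _ ^ 2` for the same `x`. -/
theorem exists_common_sq_sub_mul_sq_of_unit [Finite F]
    (hv : ∀ x, v x < 1 → IsSquare (1 + x))
    (hsurj : Function.Surjective f) (hker : ∀ x, f x = 0 ↔ v x < 1) (h2 : v 2 = 1)
    {a q₁ q₂ : L} (ha : v a = 1) (hna : ¬ IsSquare a) (h₁ : v q₁ = 1) (h₂ : v q₂ = 1) :
    ∃ x y z : L, x ^ 2 - a * z ^ 2 = q₁ ∧ x ^ 2 - a * y ^ 2 = q₂ := by
  have hunit : ∀ x : v.integer, v (x : L) = 1 → f x ≠ 0 :=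
    fun x hx h0 => (((hker x).mp h0).trans_eq hx.symm).false
  lift a to v.integer using ha.le
  lift q₁ to v.integer using h₁.le
  lift q₂ to v.integer using h₂.le
  have hF : ringChar F ≠ 2 := by
    intro h
    have : (2 : F) = 0 := by
      have := (ringChar.spec F 2).mpr (by rw [h])
      exact_mod_cast this
    exact hunit 2 (by exact_mod_cast h2) (by rw [map_ofNat, this])
  have hna' : ¬ IsSquare (f a) := by
    rintro ⟨r, hr⟩
    obtain ⟨r, rfl⟩ := hsurj r
    refine hna (isSquare_of_residue_eq_sq hv hker (r := r) ?_ (by rw [hr, sq]))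
    rintro h0
    rw [h0, mul_zero] at hr
    exact hunit a ha hr
  obtain ⟨x, y, z, hz, hy, hyz⟩ :=
    exists_common_sq_sub_mul_sq hF hna' (hunit q₁ h₁) (hunit q₂ h₂)
  have aux : ∀ {q p : v.integer} {x y : F}, f q ≠ 0 → x ^ 2 = f q → y ≠ 0 →
      x ^ 2 - f a * y ^ 2 = f p → ∃ X Y : L, X ^ 2 = q ∧ X ^ 2 - a * Y ^ 2 = p := by
    intro q p x y hq hx hy0 hy
    obtain ⟨x, rfl⟩ := hsurj x
    obtain ⟨X, hX⟩ := isSquare_of_residue_eq_sq hv hker (w := q) (r := x)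
      (by rintro h0; rw [h0] at hx; exact hq (by rw [← hx]; ring)) hx.symm
    have hXv : v X ≤ 1 := by
      have : v X ^ 2 ≤ 1 := by rw [← map_pow, sq, ← hX]; exact q.2
      exact (pow_le_one_iff two_ne_zero).mp this
    lift X to v.integer using hXv
    have hX' : X ^ 2 = q := by
      apply Subtype.ext
      push_cast
      rw [hX, sq]
    obtain ⟨Y, hY⟩ := exists_sq_sub_eq_of_residue hv hsurj hker (x := X) (q := p) ha hy0
      (by rw [← map_pow, hX', ← hx, hy])
    exact ⟨X, Y, by rw [hX, sq], hY⟩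
  by_cases hz0 : z = 0
  · have hy0 : y ≠ 0 := hyz.resolve_right (not_not.mpr hz0)
    obtain ⟨X, Y, hX, hY⟩ := aux (hunit q₁ h₁) (by rw [← hz, hz0]; ring) hy0 hy
    exact ⟨X, Y, 0, by rw [hX]; ring, hY⟩
  by_cases hy0 : y = 0
  · obtain ⟨X, Z, hX, hZ⟩ := aux (hunit q₂ h₂) (by rw [← hy, hy0]; ring) hz0 hz
    exact ⟨X, 0, Z, hZ, by rw [hX]; ring⟩
  obtain ⟨x, rfl⟩ := hsurj x
  obtain ⟨Z, hZ⟩ := exists_sq_sub_eq_of_residue hv hsurj hker ha hz0 hz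
  obtain ⟨Y, hY⟩ := exists_sq_sub_eq_of_residue hv hsurj hker ha hy0 hy
  exact ⟨x, Y, Z, hZ, hY⟩

end Residue

theorem exists_unit_sub_unit_sub_unit (h2 : v 2 = 1) (h3 : v 3 = 1) {A B : L}
    (hA : v A ≤ 1) (hB : v B ≤ 1) :
    ∃ u : L, v u = 1 ∧ v (u - A) = 1 ∧ v (u - B) = 1 := by
  have hle : ∀ {x y : L}, v x = 1 → v y ≤ 1 → ¬ v (x - y) < 1 → v (x - y) = 1 :=
    fun hx hy h => le_antisymm (v.map_sub_le hx.le hy) (not_lt.mp h)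
  have hdis : ∀ {x y C : L}, v (x - y) = 1 → v (x - C) < 1 → ¬ v (y - C) < 1 := by
    intro x y C h hx hy
    have := v.map_sub_lt hx hy
    rw [sub_sub_sub_cancel_right, h] at this
    exact this.false
  have e1 : v (1 - (-1) : L) = 1 := by rw [show (1 - (-1) : L) = 2 by norm_num, h2]
  have e2 : v (1 - 2 : L) = 1 := by rw [show (1 - 2 : L) = -1 by norm_num]; simp
  have e3 : v (-1 - 2 : L) = 1 := by rw [show (-1 - 2 : L) = -3 by norm_num, Valuation.map_neg, h3]
  have hm : v (-1 : L) = 1 := by simp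
  have h1 : v (1 : L) = 1 := v.map_one
  by_cases hA1 : v (1 - A) < 1
  · by_cases hBm : v (-1 - B) < 1
    · exact ⟨2, h2, hle h2 hA (hdis e2 hA1), hle h2 hB (hdis e3 hBm)⟩
    · exact ⟨-1, hm, hle hm hA (hdis e1 hA1), hle hm hB hBm⟩
  · by_cases hB1 : v (1 - B) < 1
    · by_cases hAm : v (-1 - A) < 1
      · exact ⟨2, h2, hle h2 hA (hdis e3 hAm), hle h2 hB (hdis e2 hB1)⟩
      · exact ⟨-1, hm, hle hm hA hAm, hle hm hB (hdis e1 hB1)⟩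
    · exact ⟨1, h1, hle h1 hA hA1, hle h1 hB hB1⟩

theorem exists_unit_valuation_sub_mul_sub_of_unit (h2 : v 2 = 1) (h3 : v 3 = 1) {A B C : L}
    (hA : v A = 1) (hC0 : C ≠ 0) (hC : v C < 1) :
    ∃ u : L, v u = 1 ∧ v ((u - A) * (u - B)) = v C ^ 2 := by
  have hvC : 0 < v C := zero_lt_iff.mpr (v.ne_zero_iff.mpr hC0)
  rcases le_or_gt (v (B - A)) (v C) with h | h
  · have he : v ((B - A) / C) ≤ 1 := by rw [map_div₀]; exact div_le_one_of_le₀ h zero_le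
    obtain ⟨ε, hε, hεe, -⟩ := exists_unit_sub_unit_sub_unit h2 h3 he he
    refine ⟨A + C * ε, ?_, ?_⟩
    · rw [v.map_add_eq_of_lt_left, hA]
      rw [map_mul, hε, mul_one, hA]
      exact hC
    · have : (A + C * ε - A) * (A + C * ε - B) = C ^ 2 * ε * (ε - (B - A) / C) := by
        field_simp; ring
      rw [this, map_mul, map_mul, hε, hεe, map_pow, mul_one, mul_one]
  · have hBA : B - A ≠ 0 := fun h0 => by
      rw [h0, map_zero] at h; exact not_lt_zero h
    have hlt : v (C ^ 2 / (B - A)) < v C := by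
      rw [map_div₀, map_pow, div_lt_iff₀ (hvC.trans h), sq]
      exact mul_lt_mul_of_pos_left h hvC
    refine ⟨A + C ^ 2 / (B - A), ?_, ?_⟩
    · rw [v.map_add_eq_of_lt_left, hA]
      rw [hA]
      exact hlt.trans hC
    · have h4 : A + C ^ 2 / (B - A) - B = C ^ 2 / (B - A) - (B - A) := by ring
      rw [add_sub_cancel_left, h4, map_mul, v.map_sub_eq_of_lt_right (hlt.trans h), ← map_mul,
        div_mul_cancel₀ _ hBA, map_pow]

/-- Used to choose the ratio `u / v` on the surface: it makes both right-hand sides have the same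
even valuation. -/
theorem exists_unit_valuation_sub_mul_sub (h2 : v 2 = 1) (h3 : v 3 = 1) {A B C : L}
    (hA : v A ≤ 1) (hB : v B ≤ 1) (hC : v C ≤ 1) (hC0 : C ≠ 0)
    (hABC : v A = 1 ∨ v B = 1 ∨ v C = 1) :
    ∃ u : L, v u = 1 ∧ v ((u - A) * (u - B)) = v C ^ 2 := by
  rcases hC.lt_or_eq with hC' | hC'
  · rcases hABC with h | h | h
    · exact exists_unit_valuation_sub_mul_sub_of_unit h2 h3 h hC0 hC'
    · simp only [mul_comm (_ - A)]
      exact exists_unit_valuation_sub_mul_sub_of_unit h2 h3 h hC0 hC'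
    · exact absurd h hC'.ne
  · obtain ⟨u, hu, huA, huB⟩ := exists_unit_sub_unit_sub_unit h2 h3 hA hB
    exact ⟨u, hu, by rw [map_mul, huA, huB, hC', one_pow, mul_one]⟩

end Valuation

section Surface

variable {L : Type*} [Field L]

theorem SPoint.of_isSquare {a b A B C : L} (ha : IsSquare a) : SPoint a b A B C := by
  obtain ⟨r, rfl⟩ := ha
  exact ⟨r, 1, 1, 0, 0, by simp, by ring, by ring⟩

theorem SPoint.of_isSquare_left {a b A B C : L} (hA : IsSquare A) : SPoint a b A B C := by
  obtain ⟨r, rfl⟩ := hA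
  exact ⟨0, C * r, 0, r * r, 1, by simp, by ring, by ring⟩

theorem SPoint.of_eq_zero {a b A B C : L} (hC : C = 0) : SPoint a b A B C :=
  ⟨0, 0, 0, A, 1, by simp, by ring, by rw [hC]; ring⟩

theorem SPoint.of_scale {a b A B C l : L} (hl : l ≠ 0)
    (h : SPoint a b (l ^ 2 * A) (l ^ 2 * B) (l * C)) : SPoint a b A B C := by
  obtain ⟨x, y, z, u, v, h0, h1, h2⟩ := h
  refine ⟨x, y, z, u, l ^ 2 * v, ?_, by rw [h1]; ring, by rw [h2]; ring⟩
  simpa [hl] using h0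

theorem Aval_eq (a b c d : L) (h g : ℕ) (θ : L) : Aval a b c d h g θ =
    a * (a ^ (2 * h + 1) * θ ^ (g + 1)) ^ 2 +
      b * c ^ 2 * d * (b ^ (2 * h + 1) * (a ^ (2 * h + 1) * θ ^ (g + 1)) - 1) ^ 2 := by
  simp only [Aval, Dval]
  ring

theorem Bval_eq (a b c d : L) (h g : ℕ) (θ : L) : Bval a b c d h g θ =
    a * (a ^ (2 * h + 1) * θ ^ (g + 1)) ^ 2 + (b * c ^ 2 * d + 2 * c) *
      (b ^ (2 * h + 1) * (a ^ (2 * h + 1) * θ ^ (g + 1)) - 1) ^ 2 := by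
  simp only [Bval, Dval]
  ring

theorem SAllFibers.of_isSquare {h g : ℕ} {a b c d : L} (ha : IsSquare a) :
    SAllFibers h g a b c d :=
  ⟨fun _ => .of_isSquare ha, .of_isSquare ha⟩

/-- All fibers have points as soon as all fibers over the projective line with homogeneous
coordinate `(t : s) = (a ^ (2 * h + 1) * θ ^ (g + 1) : 1)` do. -/
theorem SAllFibers.of_homogeneous {Γ : Type*} [LinearOrderedCommGroupWithZero Γ]
    {v : Valuation L Γ} {h g : ℕ} {a b c d : L} (ha : v a = 1)
    (H : ∀ t s : L, v t ≤ 1 → v s ≤ 1 → (v t = 1 ∨ v s = 1) →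
      SPoint a b (a * t ^ 2 + b * c ^ 2 * d * (b ^ (2 * h + 1) * t - s) ^ 2)
        (a * t ^ 2 + (b * c ^ 2 * d + 2 * c) * (b ^ (2 * h + 1) * t - s) ^ 2) (t - s)) :
    SAllFibers h g a b c d := by
  refine ⟨fun θ => ?_, ?_⟩
  · rw [Aval_eq, Bval_eq, Cval]
    generalize a ^ (2 * h + 1) * θ ^ (g + 1) = t
    rcases le_or_gt (v t) 1 with ht | ht
    · exact H t 1 ht v.map_one.le (Or.inr v.map_one)
    · have ht0 : t ≠ 0 := by rintro rfl; simp at ht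
      refine SPoint.of_scale (inv_ne_zero ht0) ?_
      convert H 1 t⁻¹ v.map_one.le (by rw [map_inv₀]; exact inv_le_one_of_one_le₀ ht.le)
        (Or.inl v.map_one) using 1 <;> field_simp
  · have := H (a ^ (2 * h + 1)) 0 (by simp [ha]) (by simp) (by simp [ha])
    convert this using 1
    · simp only [Ainf, Dinf]; ring
    · simp only [Binf, Dinf]; ring
    · simp only [Cinf, sub_zero]

section Valuation

variable {Γ F : Type*} [LinearOrderedCommGroupWithZero Γ] {v : Valuation L Γ} [Field F] [Finite F]
  {f : v.integer →+* F}

theorem SAllFibers.of_valuation_eq_one (hv : ∀ x, v x < 1 → IsSquare (1 + x))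
    (hsurj : Function.Surjective f) (hker : ∀ x, f x = 0 ↔ v x < 1) (h2 : v 2 = 1) (h3 : v 3 = 1)
    {h g : ℕ} {a b c d : L} (ha : v a = 1) (hb : v b = 1) (hc : v c ≤ 1) (hd : v d ≤ 1) :
    SAllFibers h g a b c d := by
  by_cases hna : IsSquare a
  · exact .of_isSquare hna
  refine .of_homogeneous ha fun t s ht hs hts => ?_
  set D := b ^ (2 * h + 1) * t - s with hD
  set C := t - s with hCdef
  have hDv : v D ≤ 1 := v.map_sub_le (by simpa [hb] using ht) hs
  have hCv : v C ≤ 1 := v.map_sub_le ht hs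
  have hat : v (a * t ^ 2) ≤ 1 := by
    simpa [ha] using pow_le_one' ht 2
  have hcD : v (c * D ^ 2) ≤ 1 := by
    rw [map_mul, map_pow]; exact mul_le_one' hc (pow_le_one' hDv 2)
  have hbcd : v (b * c * d) ≤ 1 := by
    rw [map_mul, map_mul, hb, one_mul]; exact mul_le_one' hc hd
  have hA : v (a * t ^ 2 + b * c ^ 2 * d * D ^ 2) ≤ 1 := by
    rw [show b * c ^ 2 * d * D ^ 2 = b * c * d * (c * D ^ 2) by ring]
    refine v.map_add_le hat ?_
    rw [map_mul]; exact mul_le_one' hbcd hcD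
  have hBA : a * t ^ 2 + (b * c ^ 2 * d + 2 * c) * D ^ 2 =
      (a * t ^ 2 + b * c ^ 2 * d * D ^ 2) + 2 * (c * D ^ 2) := by ring
  have hB : v (a * t ^ 2 + (b * c ^ 2 * d + 2 * c) * D ^ 2) ≤ 1 := by
    rw [hBA]
    refine v.map_add_le hA ?_
    rw [map_mul, h2, one_mul]; exact hcD
  by_cases hC0 : C = 0
  · exact .of_eq_zero hC0
  have hABC : v (a * t ^ 2 + b * c ^ 2 * d * D ^ 2) = 1 ∨
      v (a * t ^ 2 + (b * c ^ 2 * d + 2 * c) * D ^ 2) = 1 ∨ v C = 1 := by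
    by_contra! hcon
    obtain ⟨hA1, hB1, hC1⟩ := hcon
    replace hA1 := lt_of_le_of_ne hA hA1
    replace hB1 := lt_of_le_of_ne hB hB1
    replace hC1 := lt_of_le_of_ne hCv hC1
    have h4 : v (c * D ^ 2) < 1 := by
      have := v.map_sub_lt hB1 hA1
      rwa [hBA, add_sub_cancel_left, map_mul, h2, one_mul] at this
    have h5 : v (a * t ^ 2) < 1 := by
      have h6 : v (b * c * d * (c * D ^ 2)) < 1 := by
        rw [map_mul]; exact (mul_le_of_le_one_left' hbcd).trans_lt h4
      have := v.map_sub_lt hA1 h6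
      rwa [show a * t ^ 2 + b * c ^ 2 * d * D ^ 2 - b * c * d * (c * D ^ 2) = a * t ^ 2 by ring]
        at this
    have h6 : v t < 1 := by
      rw [map_mul, ha, one_mul, map_pow] at h5
      exact (pow_lt_one_iff two_ne_zero).mp h5
    have h7 : v s < 1 := by
      have := v.map_sub_lt h6 hC1
      rwa [hCdef, sub_sub_cancel] at this
    rcases hts with h | h
    · exact h6.ne h
    · exact h7.ne h
  generalize a * t ^ 2 + b * c ^ 2 * d * D ^ 2 = A at *
  generalize a * t ^ 2 + (b * c ^ 2 * d + 2 * c) * D ^ 2 = B at *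
  obtain ⟨u, hu, huAB⟩ := exists_unit_valuation_sub_mul_sub h2 h3 hA hB hCv hC0 hABC
  obtain ⟨x, y, z, hz, hy⟩ := exists_common_sq_sub_mul_sq_of_unit hv hsurj hker h2 ha hna
    (q₁ := -(b * ((u - A) * (u - B)) / C ^ 2)) (q₂ := -(a * u))
    (by rw [Valuation.map_neg, map_div₀, map_mul, huAB, hb, map_pow, one_mul, div_self]
        exact pow_ne_zero _ (v.ne_zero_iff.mpr hC0))
    (by rw [Valuation.map_neg, map_mul, ha, hu, one_mul])
  refine ⟨C * x, C * y, C * z, u, 1, by simp, ?_, ?_⟩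
  · field_simp at hz
    linear_combination hz
  · linear_combination C ^ 2 * hy

end Valuation

theorem SAllFibers.of_valuation_lt_one {Γ : Type*} [LinearOrderedCommGroupWithZero Γ]
    {v : Valuation L Γ} (hv : ∀ x, v x < 1 → IsSquare (1 + x)) {h g : ℕ} (hg : Odd g)
    {a b c d : L} (ha : v a < 1) (ha0 : a ≠ 0) (hb : IsSquare b) (hd : IsSquare d)
    (hb1 : v b = 1) (hbcd : v (b * c ^ 2 * d) = 1) : SAllFibers h g a b c d := by
  have hsq : IsSquare (b * c ^ 2 * d) := (hb.mul (IsSquare.sq c)).mul hd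
  have hA : ∀ t D : L, v (a * t ^ 2) < v D ^ 2 →
      IsSquare (a * t ^ 2 + b * c ^ 2 * d * D ^ 2) := by
    intro t D hlt
    obtain ⟨r, hr⟩ := hsq.mul (IsSquare.sq D)
    refine isSquare_of_valuation_sub_sq_lt hv (r := r) ?_
    rw [sq r, ← hr, add_sub_cancel_right, map_mul v (b * c ^ 2 * d), hbcd, one_mul, map_pow]
    exact hlt
  refine ⟨fun θ => ?_, ?_⟩
  · rw [Aval_eq]
    by_cases hna : IsSquare a
    · exact .of_isSquare hna
    refine .of_isSquare_left (hA _ _ ?_)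
    have hns : ∀ t, a ^ (2 * h + 1) * θ ^ (g + 1) = t → t ≠ 0 → ¬ IsSquare t := by
      rintro t ht ht0 ⟨r, hr⟩
      obtain ⟨k, hk⟩ := hg.add_one
      have hθ : θ ^ k ≠ 0 := by
        rintro h0
        rw [hk, pow_add θ, h0, mul_zero, mul_zero] at ht
        exact ht0 ht.symm
      refine hna ⟨r / (θ ^ k * a ^ h), ?_⟩
      rw [hk] at ht
      field_simp
      linear_combination ht + hr
    generalize a ^ (2 * h + 1) * θ ^ (g + 1) = t at hns ⊢
    replace hns := hns t rfl
    have hbt : v (b ^ (2 * h + 1) * t) = v t := by rw [map_mul, map_pow, hb1, one_pow, one_mul]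
    rw [map_mul, map_pow]
    rcases lt_trichotomy (v t) 1 with ht | ht | ht
    · rw [v.map_sub_eq_of_lt_right (by rw [hbt, v.map_one]; exact ht), v.map_one, one_pow]
      exact mul_lt_one_of_lt_of_le ha (pow_le_one' ht.le 2)
    · suffices v (b ^ (2 * h + 1) * t - 1) = 1 by rw [this, ht, one_pow, mul_one]; exact ha
      by_contra hne
      have hlt : v (b ^ (2 * h + 1) * t - 1) < 1 :=
        lt_of_le_of_ne (v.map_sub_le (by rw [hbt, ht]) v.map_one.le) hne
      have h1 := hv _ hlt
      rw [add_sub_cancel] at h1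
      have hb0 : b ≠ 0 := by rintro rfl; simp at hb1
      refine hns (by rintro rfl; simp at ht) ?_
      have := h1.div (hb.pow (2 * h + 1))
      rwa [mul_div_cancel_left₀ _ (pow_ne_zero _ hb0)] at this
    · rw [v.map_sub_eq_of_lt_left (by rw [hbt, v.map_one]; exact ht), hbt]
      exact mul_lt_of_lt_one_left (pow_pos (zero_lt_one.trans ht) 2) ha
  · refine .of_isSquare_left ?_
    convert hA (a ^ (2 * h + 1)) (Dinf a b h) ?_ using 1
    · simp only [Ainf]; ring
    · simp only [Dinf, map_mul, map_pow, hb1, one_pow, mul_one]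
      exact mul_lt_of_lt_one_left
        (pow_pos (pow_pos (zero_lt_iff.mpr (v.ne_zero_iff.mpr ha0)) _) 2) ha

end Surface

section LocalField

open scoped NNReal

theorem isSquare_one_add_of_norm_lt_one {L : Type*} [NormedField L] [IsUltrametricDist L]
    [CompleteSpace L] (h2 : ‖(2 : L)‖ = 1) {x : L} (hx : ‖x‖ < 1) : IsSquare (1 + x) := by
  have h20 : (2 : L) ≠ 0 := fun h0 => by simp [h0] at h2
  let φ : L → L := fun y => (x - y ^ 2) / 2
  set s : Set L := Metric.closedBall 0 ‖x‖ with hs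
  have hmap : Set.MapsTo φ s s := by
    intro y hy
    rw [hs, mem_closedBall_zero_iff] at hy ⊢
    have hy2 : ‖y ^ 2‖ ≤ ‖x‖ := by
      rw [norm_pow]
      calc ‖y‖ ^ 2 ≤ ‖y‖ := pow_le_of_le_one (norm_nonneg _) (hy.trans hx.le) two_ne_zero
        _ ≤ ‖x‖ := hy
    rw [norm_div, h2, div_one, sub_eq_add_neg]
    exact (IsUltrametricDist.norm_add_le_max _ _).trans (max_le le_rfl (by rwa [norm_neg]))
  have hcontr : ContractingWith ‖x‖₊ (hmap.restrict φ s s) := by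
    refine ⟨by exact_mod_cast hx, LipschitzWith.of_dist_le_mul ?_⟩
    rintro ⟨y, hy⟩ ⟨z, hz⟩
    rw [hs, mem_closedBall_zero_iff] at hy hz
    rw [Subtype.dist_eq, Subtype.dist_eq]
    simp only [Set.MapsTo.val_restrict_apply, coe_nnnorm]
    have h1 : φ y - φ z = (z + y) * (z - y) / 2 := by simp only [φ]; ring
    rw [dist_eq_norm, dist_eq_norm, h1, norm_div, h2, div_one, norm_mul, norm_sub_rev z y]
    gcongr
    exact (IsUltrametricDist.norm_add_le_max _ _).trans (max_le hz hy)
  obtain ⟨y, -, hy, -⟩ := hcontr.exists_fixedPoint' Metric.isClosed_closedBall.isComplete hmap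
    (x := 0) (by simp [hs]) (edist_ne_top _ _)
  refine ⟨1 + y, ?_⟩
  have hy' : (x - y ^ 2) / 2 = y := hy
  rw [div_eq_iff h20] at hy'
  linear_combination hy'

theorem finite_residueField_integer_of_properSpace (L : Type*) [NontriviallyNormedField L]
    [IsUltrametricDist L] [ProperSpace L] :
    Finite (IsLocalRing.ResidueField (NormedField.valuation (K := L)).integer) := by
  set R := (NormedField.valuation (K := L)).integer
  have hR : (R : Set L) = Metric.closedBall 0 1 := by
    ext x
    simp [R, Valuation.mem_integer_iff, ← NNReal.coe_le_coe]
  have : CompactSpace R := isCompact_iff_compactSpace.mp (hR ▸ isCompact_closedBall 0 1)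
  refine AddSubgroup.quotient_finite_of_isOpen (IsLocalRing.maximalIdeal R).toAddSubgroup ?_
  have hI : ((IsLocalRing.maximalIdeal R).toAddSubgroup : Set R) =
      (Subtype.val : R → L) ⁻¹' Metric.ball 0 1 := by
    ext x
    rw [Set.mem_preimage, mem_ball_zero_iff]
    exact Valuation.mem_maximalIdeal_iff L (NormedField.valuation (K := L))
  rw [hI]
  exact Metric.isOpen_ball.preimage continuous_subtype_val

variable {K : Type*} [Field K] [NumberField K] (π : HeightOneSpectrum (𝓞 K))

open Valued in
theorem finite_residueField_adicCompletion :
    Finite (IsLocalRing.ResidueField (Valued.integer (π.adicCompletion K))) := by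
  let f : 𝓞 K →+* Valued.integer (π.adicCompletion K) :=
    algebraMap (𝓞 K) (π.adicCompletionIntegers K)
  have hval (k : K) : Valued.v (algebraMap K (π.adicCompletion K) k) = π.valuation K k :=
    HeightOneSpectrum.valuedAdicCompletion_eq_valuation' π k
  have hlt : ∀ x : Valued.integer (π.adicCompletion K),
      IsLocalRing.residue _ x = 0 ↔ Valued.v (x : π.adicCompletion K) < 1 := by
    intro x
    rw [IsLocalRing.residue_eq_zero_iff]
    exact Valuation.mem_maximalIdeal_iff (π.adicCompletion K) Valued.v
  have hsurj : Function.Surjective ((IsLocalRing.residue _).comp f) := by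
    intro y
    obtain ⟨x, rfl⟩ := IsLocalRing.residue_surjective y
    have hopen : IsOpen {z : π.adicCompletion K | Valued.v (z - x) < 1} := by
      simpa using! (Valued.isOpen_ball (π.adicCompletion K) 1).preimage
        (continuous_id.sub (continuous_const (y := (x : π.adicCompletion K))))
    obtain ⟨k, hk⟩ := (HeightOneSpectrum.denseRange_algebraMap K π).exists_mem_open hopen
      ⟨x, by simp⟩
    have hk1 : π.valuation K k ≤ 1 := by
      rw [← hval]
      have := Valued.v.map_add (algebraMap K (π.adicCompletion K) k - x) x
      rw [sub_add_cancel] at this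
      exact this.trans (max_le hk.le x.2)
    obtain ⟨r, hr⟩ := HeightOneSpectrum.exists_valuation_sub_lt_of_integer π hk1 1
    refine ⟨r, ?_⟩
    rw [RingHom.comp_apply, ← sub_eq_zero, ← map_sub, hlt]
    rw [← hval] at hr
    change Valued.v (algebraMap K (π.adicCompletion K) (algebraMap (𝓞 K) K r) - x) < 1
    have hadd := Valued.v.map_add (algebraMap K (π.adicCompletion K) (algebraMap (𝓞 K) K r - k))
      (algebraMap K (π.adicCompletion K) k - x)
    rw [map_sub, sub_add_sub_cancel] at hadd
    exact hadd.trans_lt (max_lt (by rwa [← map_sub]) hk)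
  have hker : ∀ r ∈ π.asIdeal, ((IsLocalRing.residue _).comp f) r = 0 := by
    intro r hr
    rw [RingHom.comp_apply, hlt]
    change Valued.v (algebraMap K (π.adicCompletion K) (algebraMap (𝓞 K) K r)) < 1
    rwa [hval, HeightOneSpectrum.valuation_lt_one_iff_mem]
  have := π.asIdeal.finiteQuotientOfFreeOfNeBot π.ne_bot
  exact Finite.of_surjective (Ideal.Quotient.lift π.asIdeal ((IsLocalRing.residue _).comp f) hker)
    (Ideal.Quotient.lift_surjective_of_surjective _ hker hsurj)

open Valued in
instance : ProperSpace (π.adicCompletion K) := by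
  rw [Valued.integer.properSpace_iff_completeSpace_and_isDiscreteValuationRing_integer_and_finite_residueField]
  exact ⟨inferInstance, inferInstanceAs (IsDiscreteValuationRing (π.adicCompletionIntegers K)),
    finite_residueField_adicCompletion π⟩

open scoped Valued in
theorem exists_valuation_localExt (L : Type u) [Field L] [Algebra (π.adicCompletion K) L]
    [FiniteDimensional (π.adicCompletion K) L] :
    ∃ (v : Valuation L ℝ≥0) (F : Type u) (_ : Field F) (_ : Finite F) (f : v.integer →+* F),
      Function.Surjective f ∧ (∀ x, f x = 0 ↔ v x < 1) ∧
      (v 2 = 1 → ∀ x, v x < 1 → IsSquare (1 + x)) ∧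
      ∀ r : 𝓞 K,
        v (algebraMap (π.adicCompletion K) L (algebraMap K _ (algebraMap (𝓞 K) K r))) ≤ 1 ∧
        (v (algebraMap (π.adicCompletion K) L (algebraMap K _ (algebraMap (𝓞 K) K r))) < 1 ↔
          r ∈ π.asIdeal) := by
  let _ : NontriviallyNormedField L := spectralNorm.nontriviallyNormedField (π.adicCompletion K) L
  let _ : NormedSpace (π.adicCompletion K) L := spectralNorm.normedSpace (π.adicCompletion K) L
  have : IsUltrametricDist L :=
    IsUltrametricDist.isUltrametricDist_of_isNonarchimedean_norm
      (isNonarchimedean_spectralNorm (K := π.adicCompletion K) (L := L))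
  have : ProperSpace L := FiniteDimensional.proper (π.adicCompletion K) L
  have hext (x : π.adicCompletion K) : ‖algebraMap (π.adicCompletion K) L x‖ = ‖x‖ :=
    spectralNorm_extends x
  have := finite_residueField_integer_of_properSpace L
  refine ⟨NormedField.valuation, _, inferInstance, this, IsLocalRing.residue _,
    IsLocalRing.residue_surjective, fun x => ?_, fun h2 x hx => ?_, fun r => ⟨?_, ?_⟩⟩
  · rw [IsLocalRing.residue_eq_zero_iff]
    exact Valuation.mem_maximalIdeal_iff L NormedField.valuation
  · refine isSquare_one_add_of_norm_lt_one (L := L) ?_ hx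
    exact congrArg NNReal.toReal h2
  · change ‖algebraMap (π.adicCompletion K) L _‖ ≤ 1
    rw [hext]
    exact FinitePlace.norm_le_one K π r
  · change ‖algebraMap (π.adicCompletion K) L _‖ < 1 ↔ _
    rw [hext]
    exact FinitePlace.norm_lt_one_iff_mem K π r

end LocalField

theorem IsDedekindDomain.HeightOneSpectrum.eq_of_mem_of_asIdeal_eq_span {R : Type*} [CommRing R]
    [IsDedekindDomain R] {v w : HeightOneSpectrum R} {x : R} (hv : v.asIdeal = Ideal.span {x})
    (hx : x ∈ w.asIdeal) : v = w := by
  refine HeightOneSpectrum.ext (v.isMaximal.eq_of_le w.isPrime.ne_top ?_)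
  rwa [hv, Ideal.span_singleton_le_iff_mem]

theorem ringChar_quotient_le_of_natCast_mem {R : Type*} [CommRing R] {I : Ideal R} {n : ℕ}
    (hn : 0 < n) (h : (n : R) ∈ I) : ringChar (R ⧸ I) ≤ n := by
  refine Nat.le_of_dvd hn (ringChar.dvd ?_)
  rw [← map_natCast (Ideal.Quotient.mk I), Ideal.Quotient.eq_zero_iff_mem.mpr h]

theorem SAllFibers.of_params {K : Type u} [Field K] [NumberField K] {h g : ℕ} (hg1 : 1 ≤ g)
    (hgodd : Odd g) {a b c d : 𝓞 K} {va vb vc vd : HeightOneSpectrum (𝓞 K)}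
    (hP : Params K g a b c d va vb vc vd) (π : HeightOneSpectrum (𝓞 K)) (L : Type u) [Field L]
    [Algebra (π.adicCompletion K) L] [FiniteDimensional (π.adicCompletion K) L] :
    SAllFibers h g (intToLocalExt π L a) (intToLocalExt π L b)
      (intToLocalExt π L c) (intToLocalExt π L d) := by
  by_cases hbad : (2 : 𝓞 K) ∈ π.asIdeal ∨ ringChar (𝓞 K ⧸ π.asIdeal) ≤ 4 * g ^ 2
  · exact .of_isSquare ((hP.sq_ab_bad π hbad).1.map (algebraMap (π.adicCompletion K) L))
  obtain ⟨h2, hchar⟩ := not_or.mp hbad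
  by_cases hπb : vb = π
  · subst hπb
    exact .of_isSquare (hP.a_sq_b.map (algebraMap (vb.adicCompletion K) L))
  obtain ⟨v, F, _, _, f, hsurj, hker, hsq, hvint⟩ := exists_valuation_localExt π L
  let φ : 𝓞 K →+* L := (algebraMap (π.adicCompletion K) L).comp
    ((algebraMap K (π.adicCompletion K)).comp (algebraMap (𝓞 K) K))
  have hle (r : 𝓞 K) : v (φ r) ≤ 1 := (hvint r).1
  have hlt (r : 𝓞 K) : v (φ r) < 1 ↔ r ∈ π.asIdeal := (hvint r).2
  have hunit {r : 𝓞 K} (hr : r ∉ π.asIdeal) : v (φ r) = 1 :=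
    (hle r).eq_of_not_lt (mt (hlt r).mp hr)
  have hv2 : v 2 = 1 := map_ofNat φ 2 ▸ hunit h2
  have hb : v (φ b) = 1 :=
    hunit fun hb => hπb (HeightOneSpectrum.eq_of_mem_of_asIdeal_eq_span hP.span_b hb)
  by_cases hπa : va = π
  · subst hπa
    have ha : a ∈ va.asIdeal := hP.span_a ▸ Ideal.mem_span_singleton_self a
    have ha0 : φ a ≠ 0 := by
      refine (map_ne_zero_iff φ ?_).mpr ?_
      · exact (algebraMap (va.adicCompletion K) L).injective.comp
          ((algebraMap K (va.adicCompletion K)).injective.comp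
            (FaithfulSMul.algebraMap_injective (𝓞 K) K))
      · rintro rfl
        exact va.ne_bot (by simpa using hP.span_a)
    have hbcd : b * c ^ 2 * d ∉ va.asIdeal := by
      intro hmem
      refine va.isPrime.ne_top ((Ideal.eq_top_iff_one _).mpr ?_)
      have := sub_mem hmem (va.asIdeal.mem_of_dvd hP.cong_bcd ha)
      rwa [sub_sub_cancel] at this
    refine SAllFibers.of_valuation_lt_one (hsq hv2) hgodd ((hlt a).mpr ha) ha0
      (hP.b_sq_a.map (algebraMap (va.adicCompletion K) L))
      (hP.d_sq_a.map (algebraMap (va.adicCompletion K) L)) hb ?_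
    have := hunit hbcd
    rwa [map_mul φ, map_mul φ, map_pow φ] at this
  · have h3 : (3 : 𝓞 K) ∉ π.asIdeal := fun h3 =>
      hchar ((ringChar_quotient_le_of_natCast_mem three_pos (by exact_mod_cast h3)).trans
        (by nlinarith))
    exact .of_valuation_eq_one (hsq hv2) hsurj hker hv2 (map_ofNat φ 3 ▸ hunit h3)
      (hunit fun ha => hπa (HeightOneSpectrum.eq_of_mem_of_asIdeal_eq_span hP.span_a ha)) hb
      (hle c) (hle d)

/-- Theorem 5.1(1) for the family of degree-4 del Pezzo surfaces: if `g` is odd and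
`g+1 ∣ 4h+2`, then for every place `v` of `K` (finite or archimedean: real and complex
embeddings give all archimedean completions, and every finite extension of an
archimedean completion is `ℝ` or `ℂ`), every finite field extension `L` of the
completion `K_v`, and every `θ ∈ L ∪ {∞}`, the surface `S_θ` has an `L`-point. -/
theorem stmt15 (K : Type u) [Field K] [NumberField K] (h g : ℕ) (hg1 : 1 ≤ g)
    (hgodd : Odd g) (hdvd : (g + 1) ∣ (4 * h + 2)) (a b c d : 𝓞 K)
    (va vb vc vd : HeightOneSpectrum (𝓞 K)) (hP : Params K g a b c d va vb vc vd) :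
    (∀ (π : HeightOneSpectrum (𝓞 K)) (L : Type u) [Field L]
        [Algebra (π.adicCompletion K) L] [FiniteDimensional (π.adicCompletion K) L],
      SAllFibers h g (intToLocalExt π L a) (intToLocalExt π L b)
        (intToLocalExt π L c) (intToLocalExt π L d)) ∧
    (∀ σ : K →+* ℝ,
      SAllFibers h g (σ (algebraMap (𝓞 K) K a)) (σ (algebraMap (𝓞 K) K b))
        (σ (algebraMap (𝓞 K) K c)) (σ (algebraMap (𝓞 K) K d))) ∧
    (∀ σ : K →+* ℂ,
      SAllFibers h g (σ (algebraMap (𝓞 K) K a)) (σ (algebraMap (𝓞 K) K b))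
        (σ (algebraMap (𝓞 K) K c)) (σ (algebraMap (𝓞 K) K d))) := by
  refine ⟨fun π L _ _ _ => .of_params hg1 hgodd hP π L, fun σ => .of_isSquare ?_,
    fun σ => .of_isSquare (IsAlgClosed.exists_eq_mul_self _)⟩
  exact Real.isSquare_iff.mpr (hP.pos_real σ).1.le
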